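/- Let S be a simple projective A-module with dim_K(S) = 1 and let P_1, P_0 be finite-dimensional projective A-modules such that every homomorphism f : P_1 → P_0 with rank(f) = r(P_1,P_0) has no nonzero direct summand of P_1 contained in Ker(f). Let 0 → S → M' → M → 0 be a short exact sequence of A-modules in which M is isomorphic to Coker(f) for some homomorphism f : P_1 → P_0 with rank(f) = r(P_1,P_0). Then M' is isomorphic to Coker(h) for some homomorphism h : P_1 → P_0 ⊕ S with rank(h) = r(P_1, P_0 ⊕ S). -/

import Mathlib

/-- The rank of an `A`-linear map between modules over a `K`-algebra `A`:
the `K`-dimension of its image. -/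
noncomputable def rk (K : Type*) [Field K] {A : Type*} [Ring A] [Algebra K A]
    {M N : Type*} [AddCommGroup M] [Module A M]
    [AddCommGroup N] [Module A N] [Module K N] [IsScalarTower K A N]
    (f : M →ₗ[A] N) : ℕ :=
  Module.finrank K ((LinearMap.range f).restrictScalars K)

/-- `rmax K A M N` is `r(M,N)`, the maximal rank of an `A`-linear map `M → N`. -/
noncomputable def rmax (K : Type*) [Field K] (A : Type*) [Ring A] [Algebra K A]
    (M N : Type*) [AddCommGroup M] [Module A M]
    [AddCommGroup N] [Module A N] [Module K N] [IsScalarTower K A N] : ℕ :=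
  sSup {n : ℕ | ∃ f : M →ₗ[A] N, rk K f = n}

/-- `U` is a direct summand of `P`: it has a complementary submodule. -/
def IsDirectSummand {A P : Type*} [Ring A] [AddCommGroup P] [Module A P]
    (U : Submodule A P) : Prop :=
  ∃ V : Submodule A P, IsCompl U V

section RankLemmas

open Module

/-- Along the line `F + t • G`, the rank drops below that of `F` only finitely often. -/
lemma finite_setOf_finrank_range_add_smul_lt {K V W : Type*} [Field K]
    [AddCommGroup V] [Module K V] [FiniteDimensional K V]
    [AddCommGroup W] [Module K W] [FiniteDimensional K W] (F G : V →ₗ[K] W) :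
    {t : K | finrank K (LinearMap.range (F + t • G)) <
      finrank K (LinearMap.range F)}.Finite := by
  obtain ⟨σ, hσ⟩ := F.rangeRestrict.exists_rightInverse_of_surjective F.range_rangeRestrict
  obtain ⟨L, hL⟩ := (LinearMap.range F).subtype.exists_leftInverse_of_injective
    (LinearMap.range F).ker_subtype
  set B : End K (LinearMap.range F) := L ∘ₗ G ∘ₗ σ with hB
  have hLF (c : LinearMap.range F) : L (F (σ c)) = c := by
    have h₁ : F (σ c) = c := congrArg Subtype.val (LinearMap.congr_fun hσ c)
    rw [h₁]
    exact LinearMap.congr_fun hL c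
  have hfin : {μ : K | B.HasEigenvalue μ}.Finite := End.finite_hasEigenvalue B
  refine (hfin.preimage (f := fun t : K => -t⁻¹)
    (fun a _ b _ h => inv_injective (neg_injective h))).subset fun t ht => ?_
  by_contra hμ
  have hinj : Function.Injective (((F + t • G).rangeRestrict) ∘ₗ σ) := by
    rw [← LinearMap.ker_eq_bot, LinearMap.ker_eq_bot']
    intro c hc
    have hc' : F (σ c) + t • G (σ c) = 0 := congrArg Subtype.val hc
    have hc'' : c + t • B c = 0 := by
      have := congrArg L hc'
      simpa [hLF, hB] using this
    by_contra hc0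
    have ht0 : t ≠ 0 := by
      rintro rfl
      simp [hc0] at hc''
    refine hμ (End.hasEigenvalue_of_hasEigenvector (x := c) ⟨End.mem_eigenspace_iff.2 ?_, hc0⟩)
    rw [neg_smul, eq_neg_iff_add_eq_zero, add_comm, ← smul_right_injective _ ht0 |>.eq_iff]
    simpa [smul_smul, ht0] using hc''
  exact (LinearMap.finrank_le_finrank_of_injective hinj).not_gt ht

variable {K : Type*} [Field K] {A : Type*} [Ring A] [Algebra K A]
  {M N : Type*} [AddCommGroup M] [Module A M]
  [AddCommGroup N] [Module A N] [Module K N] [IsScalarTower K A N]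

lemma bddAbove_setOf_rk [FiniteDimensional K N] : BddAbove {n : ℕ | ∃ f : M →ₗ[A] N, rk K f = n} :=
  ⟨finrank K N, by rintro _ ⟨f, rfl⟩; exact Submodule.finrank_le _⟩

lemma rk_le_rmax [FiniteDimensional K N] (f : M →ₗ[A] N) : rk K f ≤ rmax K A M N :=
  le_csSup bddAbove_setOf_rk ⟨f, rfl⟩

variable (K A M N) in
lemma exists_rk_eq_rmax [FiniteDimensional K N] : ∃ f : M →ₗ[A] N, rk K f = rmax K A M N :=
  Nat.sSup_mem (s := {n : ℕ | ∃ f : M →ₗ[A] N, rk K f = n}) ⟨_, 0, rfl⟩ bddAbove_setOf_rk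

variable [Module K M] [IsScalarTower K A M]

lemma rk_eq_finrank_range (f : M →ₗ[A] N) :
    rk K f = finrank K (LinearMap.range (f.restrictScalars K)) := rfl

lemma finite_setOf_rk_add_smul_lt [FiniteDimensional K M] [FiniteDimensional K N]
    (f g : M →ₗ[A] N) :
    {t : K | rk K (f + t • g) < rk K f}.Finite :=
  finite_setOf_finrank_range_add_smul_lt (f.restrictScalars K) (g.restrictScalars K)

variable {S : Type*} [AddCommGroup S] [Module A S] [Module K S] [IsScalarTower K A S]

lemma rk_le_rk_prod [FiniteDimensional K N] [FiniteDimensional K S]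
    (f : M →ₗ[A] N) (g : M →ₗ[A] S) : rk K f ≤ rk K (f.prod g) := by
  have h := Submodule.finrank_map_le (LinearMap.fst K N S)
    (LinearMap.range ((f.prod g).restrictScalars K))
  rwa [← LinearMap.range_comp] at h

lemma rk_prod_eq_of_ker_le [FiniteDimensional K M] (f : M →ₗ[A] N) (g : M →ₗ[A] S)
    (h : LinearMap.ker f ≤ LinearMap.ker g) : rk K (f.prod g) = rk K f := by
  have hker : LinearMap.ker ((f.prod g).restrictScalars K) =
      LinearMap.ker (f.restrictScalars K) := by
    ext x
    simpa using fun hx => h hx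
  have h₁ := LinearMap.finrank_range_add_finrank_ker ((f.prod g).restrictScalars K)
  have h₂ := LinearMap.finrank_range_add_finrank_ker (f.restrictScalars K)
  rw [hker] at h₁
  rw [rk_eq_finrank_range, rk_eq_finrank_range]
  omega

variable (K A M N S) in
/-- Some map into a product has maximal rank together with its first component. -/
lemma exists_rk_eq_rmax_and_rk_prod_eq_rmax [Infinite K] [FiniteDimensional K M]
    [FiniteDimensional K N] [FiniteDimensional K S] :
    ∃ (f : M →ₗ[A] N) (g : M →ₗ[A] S),
      rk K f = rmax K A M N ∧ rk K (f.prod g) = rmax K A M (N × S) := by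
  obtain ⟨h, hh⟩ := exists_rk_eq_rmax K A M (N × S)
  obtain ⟨f₁, hf₁⟩ := exists_rk_eq_rmax K A M N
  set f₀ := LinearMap.fst A N S ∘ₗ h with hf₀
  set g := LinearMap.snd A N S ∘ₗ h with hg
  have hfg : h = f₀.prod g := rfl
  have hfin₁ := finite_setOf_rk_add_smul_lt (K := K) h ((f₁ - f₀).prod 0)
  have hfin₂ := (finite_setOf_rk_add_smul_lt (K := K) f₁ (f₀ - f₁)).preimage
    (f := fun t : K => 1 - t) (fun a _ b _ h => sub_right_injective h)
  obtain ⟨t, ht⟩ := (hfin₁.union hfin₂).exists_notMem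
  simp only [Set.mem_union, Set.mem_preimage, Set.mem_ofPred_eq, not_or, not_lt] at ht
  have e₁ : f₁ + (1 - t) • (f₀ - f₁) = f₀ + t • (f₁ - f₀) := by module
  have e₂ : h + t • (f₁ - f₀).prod 0 = (f₀ + t • (f₁ - f₀)).prod g := by
    rw [hfg]
    ext x <;> simp
  rw [e₁, e₂, hh, hf₁] at ht
  exact ⟨_, g, (rk_le_rmax _).antisymm ht.2, (rk_le_rmax _).antisymm ht.1⟩

end RankLemmas

/-- If a map `g` to a simple projective module does not vanish on `T`, then `T` contains a
nonzero direct summand of the ambient module. -/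
lemma exists_isDirectSummand_le_of_not_le_ker {A P S : Type*} [Ring A]
    [AddCommGroup P] [Module A P] [AddCommGroup S] [Module A S]
    [IsSimpleModule A S] [Module.Projective A S] {T : Submodule A P} {g : P →ₗ[A] S}
    (h : ¬ T ≤ LinearMap.ker g) :
    ∃ U : Submodule A P, IsDirectSummand U ∧ U ≤ T ∧ U ≠ ⊥ := by
  have hne : g ∘ₗ T.subtype ≠ 0 := by
    intro h0
    exact h fun x hx => LinearMap.congr_fun h0 ⟨x, hx⟩
  obtain ⟨σ, hσ⟩ := Module.projective_lifting_property (g ∘ₗ T.subtype) LinearMap.id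
    (LinearMap.surjective_of_ne_zero hne)
  have hσ' (s : S) : g (σ s) = s := LinearMap.congr_fun hσ s
  refine ⟨LinearMap.range (T.subtype ∘ₗ σ), ⟨LinearMap.ker g, ?_⟩, ?_, ?_⟩
  · rw [isCompl_iff, Submodule.disjoint_def, codisjoint_iff, Submodule.eq_top_iff']
    refine ⟨?_, fun x => Submodule.mem_sup.2 ⟨σ (g x), ⟨g x, rfl⟩, x - σ (g x), ?_, by simp⟩⟩
    · rintro _ ⟨s, rfl⟩ hs
      have hs0 : s = 0 := (hσ' s).symm.trans hs
      rw [hs0, map_zero]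
    · rw [LinearMap.mem_ker, map_sub, hσ', sub_self]
  · rintro _ ⟨s, rfl⟩
    exact (σ s).2
  · intro hbot
    have := IsSimpleModule.nontrivial A S
    obtain ⟨s, hs⟩ := exists_ne (0 : S)
    have h0 : (T.subtype ∘ₗ σ) s = 0 := LinearMap.congr_fun (LinearMap.range_eq_bot.1 hbot) s
    refine hs ?_
    rw [← hσ' s]
    exact (congrArg g h0).trans (map_zero g)

/-- A surjection `P₀ → M` with kernel `range f` and `P₀` projective gives, for an extension
`M'` of `M` by `S`, a presentation of `M'` by `P₀ × S` with the same relations. -/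
lemma exists_quotient_range_prod_equiv {A S P₁ P₀ M M' : Type*} [Ring A]
    [AddCommGroup S] [Module A S] [AddCommGroup P₁] [Module A P₁]
    [AddCommGroup P₀] [Module A P₀] [Module.Projective A P₀]
    [AddCommGroup M] [Module A M] [AddCommGroup M'] [Module A M']
    (ι : S →ₗ[A] M') (π : M' →ₗ[A] M)
    (hι : Function.Injective ι) (hπ : Function.Surjective π)
    (hexact : LinearMap.range ι = LinearMap.ker π)
    (f : P₁ →ₗ[A] P₀) (e : (P₀ ⧸ LinearMap.range f) ≃ₗ[A] M) :
    ∃ g : P₁ →ₗ[A] S,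
      Nonempty (((P₀ × S) ⧸ LinearMap.range (f.prod g)) ≃ₗ[A] M') := by
  obtain ⟨l, hl⟩ := Module.projective_lifting_property π
    (e.toLinearMap ∘ₗ (LinearMap.range f).mkQ) hπ
  have hl' (p : P₀) : π (l p) = e ((LinearMap.range f).mkQ p) := LinearMap.congr_fun hl p
  have hπl (p : P₀) : π (l p) = 0 ↔ p ∈ LinearMap.range f := by
    rw [hl', LinearEquiv.map_eq_zero_iff, Submodule.mkQ_apply, Submodule.Quotient.mk_eq_zero]
  have hπι (s : S) : π (ι s) = 0 := by
    rw [← LinearMap.mem_ker, ← hexact]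
    exact ⟨s, rfl⟩
  have hmem (x : P₁) : (-(l ∘ₗ f)) x ∈ LinearMap.range ι := by
    rw [hexact, LinearMap.mem_ker, LinearMap.neg_apply, map_neg, neg_eq_zero]
    exact (hπl _).2 ⟨x, rfl⟩
  let g : P₁ →ₗ[A] S :=
    (LinearEquiv.ofInjective ι hι).symm.toLinearMap ∘ₗ (-(l ∘ₗ f)).codRestrict _ hmem
  have hg (x : P₁) : ι (g x) = -l (f x) :=
    congrArg Subtype.val ((LinearEquiv.ofInjective ι hι).apply_symm_apply
      ((-(l ∘ₗ f)).codRestrict _ hmem x))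
  have hker : LinearMap.range (f.prod g) = LinearMap.ker (l.coprod ι) := by
    ext ⟨p, s⟩
    rw [LinearMap.mem_ker, LinearMap.coprod_apply]
    constructor
    · rintro ⟨x, hx⟩
      obtain ⟨rfl, rfl⟩ := Prod.ext_iff.1 hx
      simp [hg]
    · intro hps
      have hp : π (l p) = 0 := by simpa [hπι] using congrArg π hps
      obtain ⟨x, rfl⟩ := (hπl p).1 hp
      refine ⟨x, Prod.ext rfl (hι ?_)⟩
      exact (hg x).trans (eq_neg_of_add_eq_zero_right hps).symm
  have hsurj : Function.Surjective (l.coprod ι) := by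
    intro m
    obtain ⟨p, hp⟩ := (LinearMap.range f).mkQ_surjective (e.symm (π m))
    have hm : m - l p ∈ LinearMap.range ι := by
      rw [hexact, LinearMap.mem_ker, map_sub, hl', hp, e.apply_symm_apply, sub_self]
    obtain ⟨s, hs⟩ := hm
    exact ⟨(p, s), by simp [hs]⟩
  exact ⟨g, ⟨(Submodule.quotEquivOfEq _ _ hker).trans
    ((l.coprod ι).quotKerEquivOfSurjective hsurj)⟩⟩

theorem stmt7 {K A : Type*} [Field K] [IsAlgClosed K] [Ring A] [Algebra K A]
    [FiniteDimensional K A]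
    {S : Type*} [AddCommGroup S] [Module A S] [Module K S] [IsScalarTower K A S]
    [FiniteDimensional K S]
    (hSsimple : IsSimpleModule A S) (hSproj : Module.Projective A S)
    (hSdim : Module.finrank K S = 1)
    {P₁ P₀ : Type*}
    [AddCommGroup P₁] [Module A P₁] [Module K P₁] [IsScalarTower K A P₁] [FiniteDimensional K P₁]
    [AddCommGroup P₀] [Module A P₀] [Module K P₀] [IsScalarTower K A P₀] [FiniteDimensional K P₀]
    (hP₁proj : Module.Projective A P₁) (hP₀proj : Module.Projective A P₀)
    (hyp : ∀ f : P₁ →ₗ[A] P₀, rk K f = rmax K A P₁ P₀ →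
      ∀ U : Submodule A P₁, IsDirectSummand U → U ≤ LinearMap.ker f → U = ⊥)
    {M' M : Type*}
    [AddCommGroup M'] [Module A M'] [Module K M'] [IsScalarTower K A M'] [FiniteDimensional K M']
    [AddCommGroup M] [Module A M] [Module K M] [IsScalarTower K A M] [FiniteDimensional K M]
    (ι : S →ₗ[A] M') (π : M' →ₗ[A] M)
    (hι : Function.Injective ι) (hπ : Function.Surjective π)
    (hexact : LinearMap.range ι = LinearMap.ker π)
    (hM : ∃ f : P₁ →ₗ[A] P₀, rk K f = rmax K A P₁ P₀ ∧
      Nonempty ((P₀ ⧸ LinearMap.range f) ≃ₗ[A] M)) :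
    ∃ h : P₁ →ₗ[A] (P₀ × S), rk K h = rmax K A P₁ (P₀ × S) ∧
      Nonempty (((P₀ × S) ⧸ LinearMap.range h) ≃ₗ[A] M') := by
  have : Infinite K := inferInstance
  obtain ⟨f, hf, ⟨e⟩⟩ := hM
  obtain ⟨g, hg⟩ := exists_quotient_range_prod_equiv ι π hι hπ hexact f e
  refine ⟨f.prod g, (rk_le_rmax _).antisymm ?_, hg⟩
  obtain ⟨f', g', hf', hg'⟩ := exists_rk_eq_rmax_and_rk_prod_eq_rmax K A P₁ P₀ S
  have hle : LinearMap.ker f' ≤ LinearMap.ker g' := by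
    by_contra hnot
    obtain ⟨U, hU, hUf, hU0⟩ := exists_isDirectSummand_le_of_not_le_ker hnot
    exact hU0 (hyp f' hf' U hU hUf)
  rw [← hg', rk_prod_eq_of_ker_le f' g' hle, hf', ← hf]
  exact rk_le_rk_prod f g
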